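/- (Strict domain monotonicity of the semi-eigenvalues.) Assume F satisfies (F1), (F2) and (F3). If a ≤ a₁ < b₁ ≤ b and (a₁,b₁) ≠ (a,b), then λ⁺(a₁,b₁) > λ⁺(a,b) and λ⁻(a₁,b₁) > λ⁻(a,b). -/

import Mathlib

open Set

/-- `u ∈ C²(c,d) ∩ C¹([c,d])`, with first derivative `u'` (one-sided at the endpoints)
and second derivative `u''` on the open interval. -/
def C2Fun (c d : ℝ) (u u' u'' : ℝ → ℝ) : Prop :=
  (∀ t ∈ Set.Icc c d, HasDerivWithinAt u (u' t) (Set.Icc c d) t) ∧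
  ContinuousOn u' (Set.Icc c d) ∧
  (∀ t ∈ Set.Ioo c d, HasDerivAt u' (u'' t) t) ∧
  ContinuousOn u'' (Set.Ioo c d)

/-- `μ = λ⁺(c,d)`: the problem `F(u'',u',u,t) = -μ u` on `(c,d)`, `u(c)=u(d)=0`,
has a solution which is positive on `(c,d)`. -/
def IsPosEigenvalue (F : ℝ → ℝ → ℝ → ℝ → ℝ) (c d μ : ℝ) : Prop :=
  ∃ u u' u'' : ℝ → ℝ, C2Fun c d u u' u'' ∧
    (∀ t ∈ Set.Ioo c d, F (u'' t) (u' t) (u t) t = -μ * u t) ∧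
    u c = 0 ∧ u d = 0 ∧ (∀ t ∈ Set.Ioo c d, 0 < u t)

/-- `μ = λ⁻(c,d)`: same with a negative solution. -/
def IsNegEigenvalue (F : ℝ → ℝ → ℝ → ℝ → ℝ) (c d μ : ℝ) : Prop :=
  ∃ u u' u'' : ℝ → ℝ, C2Fun c d u u' u'' ∧
    (∀ t ∈ Set.Ioo c d, F (u'' t) (u' t) (u t) t = -μ * u t) ∧
    u c = 0 ∧ u d = 0 ∧ (∀ t ∈ Set.Ioo c d, u t < 0)

open Filter Topology

namespace C2Fun

variable {c d : ℝ} {u u' u'' v v' v'' : ℝ → ℝ}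

theorem mono (h : C2Fun c d u u' u'') {c₁ d₁ : ℝ} (hc : c ≤ c₁) (hd : d₁ ≤ d) :
    C2Fun c₁ d₁ u u' u'' :=
  ⟨fun t ht => (h.1 t (Icc_subset_Icc hc hd ht)).mono (Icc_subset_Icc hc hd),
    h.2.1.mono (Icc_subset_Icc hc hd),
    fun t ht => h.2.2.1 t (Ioo_subset_Ioo hc hd ht),
    h.2.2.2.mono (Ioo_subset_Ioo hc hd)⟩

theorem continuousOn (h : C2Fun c d u u' u'') : ContinuousOn u (Icc c d) :=
  fun t ht => (h.1 t ht).continuousWithinAt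

theorem hasDerivAt (h : C2Fun c d u u' u'') {t : ℝ} (ht : t ∈ Ioo c d) :
    HasDerivAt u (u' t) t :=
  (h.1 t (Ioo_subset_Icc_self ht)).hasDerivAt (Icc_mem_nhds ht.1 ht.2)

theorem const_mul_sub (hu : C2Fun c d u u' u'') (hv : C2Fun c d v v' v'') (k : ℝ) :
    C2Fun c d (fun t => k * u t - v t) (fun t => k * u' t - v' t)
      (fun t => k * u'' t - v'' t) :=
  ⟨fun t ht => ((hu.1 t ht).const_mul k).sub (hv.1 t ht),
    (continuousOn_const.mul hu.2.1).sub hv.2.1,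
    fun t ht => ((hu.2.2.1 t ht).const_mul k).sub (hv.2.2.1 t ht),
    (continuousOn_const.mul hu.2.2.2).sub hv.2.2.2⟩

theorem neg (hu : C2Fun c d u u' u'') :
    C2Fun c d (fun t => -u t) (fun t => -u' t) (fun t => -u'' t) :=
  ⟨fun t ht => (hu.1 t ht).neg, hu.2.1.neg, fun t ht => (hu.2.2.1 t ht).neg, hu.2.2.2.neg⟩

theorem reflect (hu : C2Fun c d u u' u'') :
    C2Fun (-d) (-c) (fun t => u (-t)) (fun t => -u' (-t)) (fun t => u'' (-t)) := by
  have hm : MapsTo (fun t : ℝ => -t) (Icc (-d) (-c)) (Icc c d) := fun t ht =>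
    ⟨by linarith [ht.2], by linarith [ht.1]⟩
  have hm' : MapsTo (fun t : ℝ => -t) (Ioo (-d) (-c)) (Ioo c d) := fun t ht =>
    ⟨by linarith [ht.2], by linarith [ht.1]⟩
  refine ⟨fun t ht => ?_, (hu.2.1.comp continuous_neg.continuousOn hm).neg, fun t ht => ?_,
    hu.2.2.2.comp continuous_neg.continuousOn hm'⟩
  · have := (hu.1 (-t) (hm ht)).comp t (hasDerivAt_neg t).hasDerivWithinAt hm
    simpa [Function.comp_def] using this
  · have := ((hu.2.2.1 (-t) (hm' ht)).comp t (hasDerivAt_neg t)).neg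
    rw [mul_neg_one, neg_neg] at this
    exact this

/-- A nonnegative function with `z'' ≤ C (|z'| + |z|)` and vanishing Cauchy data at the left
endpoint vanishes identically. -/
theorem eq_zero_of_left {z z' z'' : ℝ → ℝ} (hz : C2Fun c d z z' z'') {C : ℝ} (hC : 0 ≤ C)
    (hle : ∀ t ∈ Ioo c d, z'' t ≤ C * (|z' t| + |z t|)) (hnn : ∀ t ∈ Icc c d, 0 ≤ z t)
    (h0 : z c = 0) (h0' : z' c = 0) : ∀ t ∈ Icc c d, z t = 0 := by
  set f : ℝ → ℝ := fun t => z t + max (z' t) 0 with hf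
  have hfc : ContinuousOn f (Icc c d) :=
    hz.continuousOn.add (hz.2.1.sup continuousOn_const)
  have hzf : ∀ t, z t ≤ f t := fun t => le_add_of_nonneg_right (le_max_right _ _)
  have key : ∀ s ∈ Ioo c d, ∀ x ∈ Icc s d, f x ≤ f s * Real.exp ((C + 1) * (x - s)) := by
    intro s hs x hx
    have := le_gronwallBound_of_liminf_deriv_right_le (f := f) (f' := fun t => (C + 1) * f t)
      (δ := f s) (K := C + 1) (ε := 0) (a := s) (b := d)
      (hfc.mono (Icc_subset_Icc_left hs.1.le)) ?_ le_rfl (fun y _ => by simp) x hx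
    · rwa [gronwallBound_ε0] at this
    intro y hy r hr
    have hy' : y ∈ Ioo c d := ⟨hs.1.trans_le hy.1, hy.2⟩
    have hzy := hnn y (Ioo_subset_Icc_self hy')
    have t1 := (hasDerivWithinAt_iff_tendsto_slope' (self_notMem_Ioi)).1
      ((hz.hasDerivAt hy').hasDerivWithinAt (s := Ioi y))
    have t2 := (hasDerivWithinAt_iff_tendsto_slope' (self_notMem_Ioi)).1
      ((hz.2.2.1 y hy').hasDerivWithinAt (s := Ioi y))
    simp only [slope_fun_def, smul_eq_mul, vsub_eq_sub] at t1 t2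
    refine Eventually.frequently ?_
    rcases lt_or_ge (z' y) 0 with hneg | hpos
    · have hfy : f y = z y := by simp [hf, hneg.le]
      have e1 : ∀ᶠ w in 𝓝[>] y, z' w < 0 :=
        ((hz.2.2.1 y hy').continuousAt.eventually (gt_mem_nhds hneg)).filter_mono
          nhdsWithin_le_nhds
      have hr' : z' y < r := by
        have : 0 ≤ (C + 1) * f y := by rw [hfy]; positivity
        linarith
      filter_upwards [e1, t1.eventually (gt_mem_nhds hr')] with w h1 h2
      have : f w = z w := by simp [hf, h1.le]
      rwa [this, hfy]
    · have hfy : f y = z y + z' y := by simp [hf, hpos]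
      have hm : max (z'' y) 0 ≤ C * (z' y + z y) := by
        refine max_le ?_ (by positivity)
        have := hle y hy'
        rwa [abs_of_nonneg hpos, abs_of_nonneg hzy] at this
      have hr' : z' y + max (z'' y) 0 < r := by
        have : (C + 1) * f y = C * (z' y + z y) + (z y + z' y) := by rw [hfy]; ring
        linarith
      have t3 := t1.add (t2.max (tendsto_const_nhds (x := (0 : ℝ))))
      filter_upwards [t3.eventually (gt_mem_nhds hr'), self_mem_nhdsWithin] with w h2 hw
      refine lt_of_le_of_lt ?_ h2
      have hw' : 0 ≤ (w - y)⁻¹ := inv_nonneg.2 (sub_nonneg.2 (le_of_lt hw))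
      have hmul : (w - y)⁻¹ * max (z' w - z' y) 0 = max ((w - y)⁻¹ * (z' w - z' y)) 0 := by
        rw [mul_max_of_nonneg _ _ hw', mul_zero]
      rw [← hmul, ← mul_add]
      refine mul_le_mul_of_nonneg_left ?_ hw'
      have h3 : max (z' w) 0 ≤ max (z' w - z' y) 0 + z' y := by
        refine max_le ?_ ?_
        · linarith [le_max_left (z' w - z' y) 0]
        · linarith [le_max_right (z' w - z' y) 0]
      rw [hfy]
      simp only [hf]
      linarith
  intro t ht
  rcases ht.1.eq_or_lt with rfl | hct
  · exact h0
  have hcd : c < d := hct.trans_le ht.2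
  refine le_antisymm ((hzf t).trans ?_) (hnn t ht)
  have hfc0 : f c = 0 := by simp [hf, h0, h0']
  have l1 : Tendsto f (𝓝[>] c) (𝓝 0) := by
    have := (hfc c (left_mem_Icc.2 hcd.le)).mono_left
      (nhdsWithin_le_of_mem (Icc_mem_nhdsGT hcd))
    rwa [hfc0] at this
  have l2 : Tendsto (fun s => Real.exp ((C + 1) * (t - s))) (𝓝[>] c)
      (𝓝 (Real.exp ((C + 1) * (t - c)))) :=
    (Continuous.tendsto (by fun_prop) c).mono_left nhdsWithin_le_nhds
  have l3 := l1.mul l2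
  rw [zero_mul] at l3
  refine ge_of_tendsto l3 ?_
  filter_upwards [Ioo_mem_nhdsGT hct] with s hs
  exact key s ⟨hs.1, hs.2.trans_le ht.2⟩ t ⟨hs.2.le, ht.2⟩

/-- A nonnegative function with `z'' ≤ C (|z'| + |z|)` whose Cauchy data vanish at some point
vanishes identically. -/
theorem eq_zero_of_mem {z z' z'' : ℝ → ℝ} (hz : C2Fun c d z z' z'') {C : ℝ} (hC : 0 ≤ C)
    (hle : ∀ t ∈ Ioo c d, z'' t ≤ C * (|z' t| + |z t|)) (hnn : ∀ t ∈ Icc c d, 0 ≤ z t)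
    {t₀ : ℝ} (ht₀ : t₀ ∈ Icc c d) (h0 : z t₀ = 0) (h0' : z' t₀ = 0) :
    ∀ t ∈ Icc c d, z t = 0 := by
  intro t ht
  rcases le_total t₀ t with h | h
  · exact (hz.mono ht₀.1 le_rfl).eq_zero_of_left hC
      (fun s hs => hle s (Ioo_subset_Ioo_left ht₀.1 hs))
      (fun s hs => hnn s (Icc_subset_Icc_left ht₀.1 hs)) h0 h0' t ⟨h, ht.2⟩
  · have := (hz.mono le_rfl ht₀.2).reflect.eq_zero_of_left hC
      (fun s hs => by
        have := hle (-s) ⟨by linarith [hs.2], by linarith [hs.1, ht₀.2]⟩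
        simpa using this)
      (fun s hs => hnn (-s) ⟨by linarith [hs.2], by linarith [hs.1, ht₀.2]⟩)
      (by simpa using h0) (by simpa using h0') (-t) ⟨by linarith, by linarith [ht.1]⟩
    simpa using this

end C2Fun

/-- The quotient `v / u` extended to the zeros of `u` by l'Hôpital's rule is continuous. -/
theorem continuousOn_div_extend {c d : ℝ} {u u' v v' : ℝ → ℝ}
    (hu : ∀ t ∈ Icc c d, HasDerivWithinAt u (u' t) (Icc c d) t)
    (hv : ∀ t ∈ Icc c d, HasDerivWithinAt v (v' t) (Icc c d) t)
    (h : ∀ t ∈ Icc c d, u t = 0 → u' t ≠ 0 ∧ v t = 0) :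
    ContinuousOn (fun t => if u t = 0 then v' t / u' t else v t / u t) (Icc c d) := by
  intro t ht
  by_cases h0 : u t = 0
  · obtain ⟨hu', hv0⟩ := h t ht h0
    have hsu := hasDerivWithinAt_iff_tendsto_slope.1 (hu t ht)
    have hsv := hasDerivWithinAt_iff_tendsto_slope.1 (hv t ht)
    rw [← continuousWithinAt_sdiff_self, ContinuousWithinAt, if_pos h0]
    refine (hsv.div hsu hu').congr' ?_
    filter_upwards [hsu.eventually_ne hu', self_mem_nhdsWithin] with s hs hst
    simp only [slope_def_field, h0, sub_zero, ne_eq, div_eq_zero_iff, not_or] at hs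
    simp only [Pi.div_apply, slope_def_field, h0, hv0, sub_zero, if_neg hs.1]
    exact div_div_div_cancel_right₀ hs.2 _ _
  · refine ((hv t ht).continuousWithinAt.div (hu t ht).continuousWithinAt h0).congr_of_eventuallyEq
      ?_ (by simp [h0])
    filter_upwards [(hu t ht).continuousWithinAt.eventually_ne h0] with s hs
    simp [hs]

theorem le_of_extremal_bound {lam Lam gam del μ m p z : ℝ} (hlam : 0 < lam)
    (hgam : 0 ≤ gam) (hdel : 0 ≤ del)
    (h : lam * max m 0 - Lam * max (-m) 0 - gam * |p| - del * |z| ≤ -μ * z) :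
    m ≤ (gam + del + |μ|) / lam * (|p| + |z|) := by
  have hp := abs_nonneg p
  have hz := abs_nonneg z
  have hμ := abs_nonneg μ
  rcases le_or_gt m 0 with hm | hm
  · exact hm.trans (by positivity)
  · rw [max_eq_left hm.le, max_eq_right (by linarith)] at h
    have h1 : -μ * z ≤ |μ| * |z| := by
      rw [← abs_mul, neg_mul]; exact neg_le_abs _
    rw [div_mul_eq_mul_div, le_div_iff₀ hlam]
    nlinarith [mul_nonneg hgam hz, mul_nonneg hdel hp, mul_nonneg hμ hp]

/-- Strict domain monotonicity of the positive semi-eigenvalue; only positive homogeneity and the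
lower extremal bound of the operator are needed. -/
theorem IsPosEigenvalue.lt_of_subinterval {a b lam Lam gam del : ℝ}
    (hlam : 0 < lam) (hgam : 0 ≤ gam) (hdel : 0 ≤ del) {F : ℝ → ℝ → ℝ → ℝ → ℝ}
    (hF1 : ∀ s : ℝ, 0 ≤ s → ∀ m p u : ℝ, ∀ t ∈ Icc a b,
      F (s * m) (s * p) (s * u) t = s * F m p u t)
    (hF2 : ∀ m p u m' p' u' : ℝ, ∀ t ∈ Icc a b,
      lam * max (m - m') 0 - Lam * max (-(m - m')) 0 - gam * |p - p'| - del * |u - u'|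
          ≤ F m p u t - F m' p' u' t)
    {a₁ b₁ : ℝ} (ha₁ : a ≤ a₁) (hab₁ : a₁ < b₁) (hb₁ : b₁ ≤ b)
    (hne : ¬(a₁ = a ∧ b₁ = b)) {μ μ₁ : ℝ}
    (h : IsPosEigenvalue F a b μ) (h₁ : IsPosEigenvalue F a₁ b₁ μ₁) : μ < μ₁ := by
  obtain ⟨u, u', u'', hu, hFu, hua, hub, hupos⟩ := h
  obtain ⟨v, v', v'', hv, hFv, hva, hvb, hvpos⟩ := h₁
  have hab : a < b := by linarith
  have hF0 : ∀ t ∈ Icc a b, F 0 0 0 t = 0 := fun t ht => by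
    simpa using hF1 0 le_rfl 0 0 0 t ht
  have hunn : ∀ t ∈ Icc a b, 0 ≤ u t := by
    intro t ht
    rcases ht.1.eq_or_lt with rfl | h1
    · exact hua.ge
    rcases ht.2.eq_or_lt with rfl | h2
    · exact hub.ge
    exact (hupos t ⟨h1, h2⟩).le
  have hC : 0 ≤ (gam + del + |μ|) / lam := by positivity
  have hopf : ∀ t ∈ Icc a b, u t = 0 → u' t ≠ 0 := by
    intro t ht h0 h0'
    have hmid : (a + b) / 2 ∈ Ioo a b := ⟨by linarith, by linarith⟩
    refine (hupos _ hmid).ne' (hu.eq_zero_of_mem hC (fun s hs => ?_) hunn ht h0 h0' _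
      (Ioo_subset_Icc_self hmid))
    refine le_of_extremal_bound (Lam := Lam) hlam hgam hdel ?_
    have hs' := Ioo_subset_Icc_self hs
    have := hF2 (u'' s) (u' s) (u s) 0 0 0 s hs'
    simpa only [hF0 s hs', sub_zero, hFu s hs] using this
  by_contra! hμ
  have hsub : Icc a₁ b₁ ⊆ Icc a b := Icc_subset_Icc ha₁ hb₁
  have hsub' : Ioo a₁ b₁ ⊆ Ioo a b := Ioo_subset_Ioo ha₁ hb₁
  have hu₁ := hu.mono ha₁ hb₁
  have hzero : ∀ t ∈ Icc a₁ b₁, u t = 0 → u' t ≠ 0 ∧ v t = 0 := by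
    refine fun t ht h0 => ⟨hopf t (hsub ht) h0, ?_⟩
    rcases ht.1.eq_or_lt with rfl | h1
    · exact hva
    rcases ht.2.eq_or_lt with rfl | h2
    · exact hvb
    exact absurd h0 (hupos t (hsub' ⟨h1, h2⟩)).ne'
  obtain ⟨t₀, ht₀, hmax⟩ := isCompact_Icc.exists_isMaxOn (nonempty_Icc.2 hab₁.le)
    (continuousOn_div_extend hu₁.1 hv.1 hzero)
  set g : ℝ → ℝ := fun t => if u t = 0 then v' t / u' t else v t / u t with hg
  set k := g t₀ with hk
  have hkpos : 0 < k := by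
    have hmid : (a₁ + b₁) / 2 ∈ Ioo a₁ b₁ := ⟨by linarith, by linarith⟩
    have hup := hupos _ (hsub' hmid)
    have : g ((a₁ + b₁) / 2) ≤ k := hmax (Ioo_subset_Icc_self hmid)
    refine lt_of_lt_of_le ?_ this
    simp only [hg, if_neg hup.ne']
    exact div_pos (hvpos _ hmid) hup
  have hznn : ∀ t ∈ Icc a₁ b₁, 0 ≤ k * u t - v t := by
    intro t ht
    by_cases h0 : u t = 0
    · simp [h0, (hzero t ht h0).2]
    · have hup : 0 < u t := lt_of_le_of_ne (hunn t (hsub ht)) (Ne.symm h0)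
      have : g t ≤ k := hmax ht
      simp only [hg, if_neg h0] at this
      rw [div_le_iff₀ hup] at this
      linarith
  have hz := hu₁.const_mul_sub hv k
  have hcauchy : k * u t₀ - v t₀ = 0 ∧ k * u' t₀ - v' t₀ = 0 := by
    by_cases h0 : u t₀ = 0
    · have hk' : k = v' t₀ / u' t₀ := by simp [hk, hg, h0]
      have hu0 := (hzero t₀ ht₀ h0).1
      refine ⟨by simp [h0, (hzero t₀ ht₀ h0).2], ?_⟩
      rw [hk', div_mul_cancel₀ _ hu0, sub_self]
    · have hk' : k = v t₀ / u t₀ := by simp [hk, hg, h0]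
      have hz0 : k * u t₀ - v t₀ = 0 := by rw [hk', div_mul_cancel₀ _ h0, sub_self]
      have hv0 : v t₀ ≠ 0 := fun hv0 => hkpos.ne' (by rw [hk', hv0, zero_div])
      have hint : t₀ ∈ Ioo a₁ b₁ :=
        ⟨lt_of_le_of_ne ht₀.1 fun h => hv0 (h ▸ hva), lt_of_le_of_ne ht₀.2 fun h => hv0 (h ▸ hvb)⟩
      refine ⟨hz0, IsLocalMin.hasDerivAt_eq_zero ?_ (hz.hasDerivAt hint)⟩
      filter_upwards [Icc_mem_nhds hint.1 hint.2] with s hs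
      rw [hz0]
      exact hznn s hs
  have hvanish := hz.eq_zero_of_mem hC (fun s hs => ?_) hznn ht₀ hcauchy.1 hcauchy.2
  · have hend : ∀ t ∈ Icc a₁ b₁, v t = 0 → ¬ 0 < u t := fun t ht hv0 hpos => by
      have := hvanish t ht
      rw [hv0, sub_zero] at this
      exact (mul_pos hkpos hpos).ne' this
    rcases ha₁.eq_or_lt with h1 | h1
    · rcases hb₁.eq_or_lt with h2 | h2
      · exact hne ⟨h1.symm, h2⟩
      · exact hend b₁ (right_mem_Icc.2 hab₁.le) hvb (hupos b₁ ⟨by linarith, h2⟩)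
    · exact hend a₁ (left_mem_Icc.2 hab₁.le) hva (hupos a₁ ⟨h1, by linarith⟩)
  · refine le_of_extremal_bound (Lam := Lam) hlam hgam hdel ?_
    have hs' := hsub (Ioo_subset_Icc_self hs)
    refine (hF2 (k * u'' s) (k * u' s) (k * u s) (v'' s) (v' s) (v s) s hs').trans ?_
    rw [hF1 k hkpos.le _ _ _ s hs', hFu s (hsub' hs), hFv s hs]
    nlinarith [mul_le_mul_of_nonneg_right hμ (hvpos s hs).le]

/-- A negative semi-eigenvalue of `F` is a positive one of `x ↦ -F (-x)`. -/
theorem IsNegEigenvalue.isPosEigenvalue_neg {F : ℝ → ℝ → ℝ → ℝ → ℝ} {c d μ : ℝ}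
    (h : IsNegEigenvalue F c d μ) :
    IsPosEigenvalue (fun m p u t => -F (-m) (-p) (-u) t) c d μ := by
  obtain ⟨u, u', u'', hu, hFu, hc, hd, hneg⟩ := h
  refine ⟨_, _, _, hu.neg, fun t ht => ?_, by simp [hc], by simp [hd], fun t ht => ?_⟩
  · simp [hFu t ht]
  · simpa using hneg t ht

/-- strict monotonicity of the semi-eigenvalues with respect to the interval:
if `(a₁,b₁) ⊂ (a,b)` with `(a₁,b₁) ≠ (a,b)` then `λ±(a₁,b₁) > λ±(a,b)`. -/
theorem stmt_7
    (a b lam Lam gam del : ℝ) (hab : a < b)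
    (hlam : 0 < lam) (hLam : lam ≤ Lam) (hgam : 0 < gam) (hdel : 0 < del)
    (F : ℝ → ℝ → ℝ → ℝ → ℝ)
    (hFcont : ContinuousOn (fun z : ℝ × ℝ × ℝ × ℝ => F z.1 z.2.1 z.2.2.1 z.2.2.2)
      {z : ℝ × ℝ × ℝ × ℝ | z.2.2.2 ∈ Icc a b})
    (hF1 : ∀ s : ℝ, 0 ≤ s → ∀ m p u : ℝ, ∀ t ∈ Icc a b,
      F (s * m) (s * p) (s * u) t = s * F m p u t)
    (hF2 : ∀ m p u m' p' u' : ℝ, ∀ t ∈ Icc a b,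
      lam * max (m - m') 0 - Lam * max (-(m - m')) 0 - gam * |p - p'| - del * |u - u'|
          ≤ F m p u t - F m' p' u' t ∧
        F m p u t - F m' p' u' t
          ≤ Lam * max (m - m') 0 - lam * max (-(m - m')) 0 + gam * |p - p'| + del * |u - u'|)
    (hF3 : ∀ m p u m' p' u' : ℝ, ∀ t ∈ Icc a b,
      -F (m' - m) (p' - p) (u' - u) t ≤ F m p u t - F m' p' u' t ∧
        F m p u t - F m' p' u' t ≤ F (m - m') (p - p') (u - u') t)
    (a₁ b₁ : ℝ) (ha₁ : a ≤ a₁) (hab₁ : a₁ < b₁) (hb₁ : b₁ ≤ b)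
    (hne : ¬(a₁ = a ∧ b₁ = b)) :
    (∀ lamP lamP₁ : ℝ, IsPosEigenvalue F a b lamP → IsPosEigenvalue F a₁ b₁ lamP₁ →
      lamP < lamP₁) ∧
    (∀ lamM lamM₁ : ℝ, IsNegEigenvalue F a b lamM → IsNegEigenvalue F a₁ b₁ lamM₁ →
      lamM < lamM₁) := by
  refine ⟨fun μ μ₁ h h₁ => h.lt_of_subinterval hlam hgam.le hdel.le hF1
    (fun m p u m' p' u' t ht => (hF2 m p u m' p' u' t ht).1) ha₁ hab₁ hb₁ hne h₁,
    fun μ μ₁ h h₁ => h.isPosEigenvalue_neg.lt_of_subinterval hlam hgam.le hdel.le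
      (Lam := Lam) ?_ ?_ ha₁ hab₁ hb₁ hne h₁.isPosEigenvalue_neg⟩
  · intro s hs m p u t ht
    have := hF1 s hs (-m) (-p) (-u) t ht
    simp only [mul_neg] at this ⊢
    rw [this]
  · intro m p u m' p' u' t ht
    have := (hF2 (-m') (-p') (-u') (-m) (-p) (-u) t ht).1
    simp only [neg_sub_neg] at this ⊢
    linarith
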